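/- Taylor remainder for rescaled test functions: given r ∈ ℕ₀ and c ∈ ℕ₀ ∪ {−1}, there exists a constant cst > 0 depending only on r, c and d such that for all test functions φ ∈ 𝓑^{r+c+1}_c and all x, y ∈ ℝ^d, n ∈ ℕ₀ with |y−x| ≤ 2^{−n}, there exists a test function ψ = ψ^{[x,y,n]} ∈ cst·𝓑^r_c with φ_x^{2^{−n}} − Σ_{|k|≤c} ((x−y)^k/k!)(−2^n)^{|k|}(∂^k φ)_y^{2^{−n}} = (2^n(x−y))^{c+1} ψ_y^{2^{−n+1}}. -/

import Mathlib

open MeasureTheory Metric Filter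
open scoped Classical Pointwise Topology

noncomputable section

/-- Euclidean space `ℝ^d`. -/
abbrev Ed (d : ℕ) := EuclideanSpace ℝ (Fin d)

/-- Multi-indices `k ∈ ℕ₀^d`. -/
abbrev MIdx (d : ℕ) := Fin d → ℕ

variable {d : ℕ}

/-- Degree `|k|` of a multi-index. -/
def mdeg (k : MIdx d) : ℕ := ∑ i, k i

/-- Factorial `k!` of a multi-index. -/
def mfact (k : MIdx d) : ℕ := ∏ i, Nat.factorial (k i)

/-- Monomial `v^k`. -/
def mpow (v : Ed d) (k : MIdx d) : ℝ := ∏ i, (v i) ^ (k i)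

/-- Partial (line) derivative in coordinate `i`. -/
def pd (i : Fin d) (f : Ed d → ℝ) : Ed d → ℝ :=
  fun x => lineDeriv ℝ f x (EuclideanSpace.single i (1:ℝ))

/-- Iterated partial derivative `∂^k`. -/
def mderiv (k : MIdx d) (f : Ed d → ℝ) : Ed d → ℝ :=
  (List.finRange d).foldr (fun i g => (pd i)^[k i] g) f

/-- Smooth compactly supported test function. -/
def IsTest (φ : Ed d → ℝ) : Prop := ContDiff ℝ (⊤ : ℕ∞) φ ∧ HasCompactSupport φ

/-- The `C^r` norm `max_{|k| ≤ r} ‖∂^k φ‖_∞`. -/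
def crNorm (r : ℕ) (φ : Ed d → ℝ) : ℝ :=
  ⨆ k : {k : MIdx d // mdeg k ≤ r}, ⨆ x : Ed d, |mderiv k.1 φ x|

/-- Generalized functions: arbitrary functionals on functions on `ℝ^d`. -/
abbrev DFunc (d : ℕ) := (Ed d → ℝ) → ℝ

/-- `f` is a distribution in `𝒟'(ℝ^d)`: linear on test functions and,
on every compact, bounded by some `C^r` norm. -/
def IsDistribution (f : DFunc d) : Prop :=
  (∀ φ ψ : Ed d → ℝ, IsTest φ → IsTest ψ → f (φ + ψ) = f φ + f ψ) ∧
  (∀ (c : ℝ) (φ : Ed d → ℝ), IsTest φ → f (c • φ) = c * f φ) ∧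
  (∀ K : Set (Ed d), IsCompact K → ∃ (r : ℕ) (C : ℝ),
    ∀ φ : Ed d → ℝ, IsTest φ → tsupport φ ⊆ K → |f φ| ≤ C * crNorm r φ)

/-- `f` is a distribution of order `r` (bound by the `C^r` norm on every compact). -/
def DistOrder (f : DFunc d) (r : ℕ) : Prop :=
  ∀ K : Set (Ed d), IsCompact K → ∃ C : ℝ,
    ∀ φ : Ed d → ℝ, IsTest φ → tsupport φ ⊆ K → |f φ| ≤ C * crNorm r φ

/-- `φ` is of class `C^r`: all iterated coordinate-partials up to order `r`
exist and are continuous. -/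
def IsCr (r : ℕ) (φ : Ed d → ℝ) : Prop :=
  ∀ k : MIdx d, mdeg k ≤ r →
    Continuous (mderiv k φ) ∧
    (mdeg k < r → ∀ (i : Fin d) (x : Ed d),
      LineDifferentiableAt ℝ (mderiv k φ) x (EuclideanSpace.single i (1:ℝ)))

/-- The functional `f` acts canonically (linearly, with local order-`r` bounds) on all
compactly supported `C^r` functions; i.e. `f` incorporates the canonical extension of a
distribution of order `r`. -/
def OrderExt (f : DFunc d) (r : ℕ) : Prop :=
  (∀ φ ψ : Ed d → ℝ, IsCr r φ → HasCompactSupport φ → IsCr r ψ → HasCompactSupport ψ →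
      f (φ + ψ) = f φ + f ψ) ∧
  (∀ (c : ℝ) (φ : Ed d → ℝ), IsCr r φ → HasCompactSupport φ → f (c • φ) = c * f φ) ∧
  (∀ K : Set (Ed d), IsCompact K → ∃ C : ℝ,
    ∀ φ : Ed d → ℝ, IsCr r φ → HasCompactSupport φ → tsupport φ ⊆ K → |f φ| ≤ C * crNorm r φ)

/-- The scaled recentred test function `φ_x^λ(y) = λ^{-d} φ(λ^{-1}(y-x))`. -/
def scTF (φ : Ed d → ℝ) (x : Ed d) (l : ℝ) : Ed d → ℝ :=
  fun y => (l ^ d)⁻¹ * φ (l⁻¹ • (y - x))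

/-- The class `𝓑^r` of smooth test functions supported in the closed unit ball with
all derivatives of order `≤ r` bounded by one. -/
def TB (d r : ℕ) : Set (Ed d → ℝ) :=
  {φ | IsTest φ ∧ tsupport φ ⊆ closedBall (0 : Ed d) 1 ∧
    ∀ k : MIdx d, mdeg k ≤ r → ∀ x, |mderiv k φ x| ≤ 1}

/-- The class `𝓑_γ` of smooth test functions supported in the closed unit ball which
annihilate all monomials of degree `≤ γ`. -/
def TAnn (d : ℕ) (γ : ℝ) : Set (Ed d → ℝ) :=
  {φ | IsTest φ ∧ tsupport φ ⊆ closedBall (0 : Ed d) 1 ∧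
    ∀ k : MIdx d, (mdeg k : ℝ) ≤ γ → (∫ z, φ z * mpow z k) = 0}

/-- The class `𝓑^r_γ = 𝓑^r ∩ 𝓑_γ`. -/
def TBAnn (d r : ℕ) (γ : ℝ) : Set (Ed d → ℝ) := TB d r ∩ TAnn d γ

/-- A germ: a family of functionals indexed by base points. -/
abbrev GermF (d : ℕ) := Ed d → DFunc d

/-- A germ of distributions, measurable in the base point. -/
def IsGerm (F : GermF d) : Prop :=
  (∀ x, IsDistribution (F x)) ∧ ∀ φ : Ed d → ℝ, IsTest φ → Measurable (fun x => F x φ)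

/-- Homogeneity bound with constant `C`: `|F_x(φ_x^λ)| ≤ C λ^ᾱ` on `(K, λ̄)` at order `r`. -/
def HomB (F : GermF d) (a : ℝ) (r : ℕ) (K : Set (Ed d)) (lb C : ℝ) : Prop :=
  ∀ x ∈ K, ∀ l : ℝ, 0 < l → l ≤ lb → ∀ φ ∈ TB d r, |F x (scTF φ x l)| ≤ C * l ^ a

/-- Coherence bound with constant `C`:
`|(F_y - F_x)(φ_x^λ)| ≤ C λ^α (|y-x|+λ)^{γ-α}` on `(K, λ̄)` at order `r`. -/
def CohB (F : GermF d) (a g : ℝ) (r : ℕ) (K : Set (Ed d)) (lb C : ℝ) : Prop :=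
  ∀ x ∈ K, ∀ y ∈ K, ∀ l : ℝ, 0 < l → l ≤ lb → ∀ φ ∈ TB d r,
    |F y (scTF φ x l) - F x (scTF φ x l)| ≤ C * l ^ a * (dist y x + l) ^ (g - a)

/-- `F` is `ᾱ`-homogeneous of order `r`. -/
def Homog (F : GermF d) (a : ℝ) (r : ℕ) : Prop :=
  ∀ K : Set (Ed d), IsCompact K → ∀ lb : ℝ, 1 ≤ lb → ∃ C, HomB F a r K lb C

/-- `F` is `(α, γ)`-coherent of order `r`. -/
def Coh (F : GermF d) (a g : ℝ) (r : ℕ) : Prop :=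
  ∀ K : Set (Ed d), IsCompact K → ∀ lb : ℝ, 1 ≤ lb → ∃ C, CohB F a g r K lb C

/-- Weak homogeneity bound with constant `C` (test functions annihilating polynomials
at small scales, plus a scale-one bound on all of `𝓑^r`). -/
def WHomB (F : GermF d) (a : ℝ) (r : ℕ) (K : Set (Ed d)) (lb C : ℝ) : Prop :=
  (∀ x ∈ K, ∀ l : ℝ, 0 < l → l ≤ lb → ∀ φ ∈ TBAnn d r a,
      |F x (scTF φ x l)| ≤ C * l ^ a) ∧
  (∀ x ∈ K, ∀ ψ ∈ TB d r, |F x (scTF ψ x 1)| ≤ C)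

/-- Weak coherence bound with constant `C`. -/
def WCohB (F : GermF d) (a g : ℝ) (r : ℕ) (K : Set (Ed d)) (lb C : ℝ) : Prop :=
  (∀ x ∈ K, ∀ y ∈ K, ∀ l : ℝ, 0 < l → l ≤ lb → ∀ φ ∈ TBAnn d r g,
      |F y (scTF φ x l) - F x (scTF φ x l)| ≤ C * l ^ a * (dist y x + l) ^ (g - a)) ∧
  (∀ x ∈ K, ∀ y ∈ K, ∀ ψ ∈ TB d r, |F y (scTF ψ x 1) - F x (scTF ψ x 1)| ≤ C)

/-- `F` is weakly `ᾱ`-homogeneous of order `r`. -/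
def WHomog (F : GermF d) (a : ℝ) (r : ℕ) : Prop :=
  ∀ K : Set (Ed d), IsCompact K → ∀ lb : ℝ, 1 ≤ lb → ∃ C, WHomB F a r K lb C

/-- `F` is weakly `(α,γ)`-coherent of order `r`. -/
def WCoh (F : GermF d) (a g : ℝ) (r : ℕ) : Prop :=
  ∀ K : Set (Ed d), IsCompact K → ∀ lb : ℝ, 1 ≤ lb → ∃ C, WCohB F a g r K lb C

/-- The canonical order `r_{ᾱ,α} = min{n ∈ ℕ₀ : n > max(-ᾱ, -α)}`. -/
def rJ (a b : ℝ) : ℕ := (⌊max (-a) (-b)⌋ + 1).toNat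

/-- Joint homogeneity-and-coherence bound at the canonical order. -/
def JointB (F : GermF d) (ab a g : ℝ) (K : Set (Ed d)) (lb C : ℝ) : Prop :=
  HomB F ab (rJ ab a) K lb C ∧ CohB F a g (rJ ab a) K lb C

/-- Joint weak homogeneity-and-coherence bound at the canonical order. -/
def WJointB (F : GermF d) (ab a g : ℝ) (K : Set (Ed d)) (lb C : ℝ) : Prop :=
  WHomB F ab (rJ ab a) K lb C ∧ WCohB F a g (rJ ab a) K lb C

/-- `R` is a `γ`-reconstruction of the `(α,γ)`-coherent germ `F`. -/
def IsRec (F : GermF d) (R : DFunc d) (a g : ℝ) : Prop :=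
  ∀ r : ℕ, -a < (r : ℝ) → ∀ K : Set (Ed d), IsCompact K → ∃ C : ℝ,
    ∀ x ∈ K, ∀ l : ℝ, 0 < l → l ≤ 1 → ∀ φ ∈ TB d r,
      |F x (scTF φ x l) - R (scTF φ x l)| ≤ C * l ^ g

/-- Mixed partial derivative `∂_1^k ∂_2^l K(x,y)` of a kernel. -/
def mixDeriv (k l : MIdx d) (Kf : Ed d → Ed d → ℝ) (x y : Ed d) : ℝ :=
  mderiv k (fun x' => mderiv l (fun y' => Kf x' y') y) x

/-- The kernel `K(x,y)` is of class `C^{m,r}` (mixed partials `∂_1^k ∂_2^l`, `|k| ≤ m`,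
`|l| ≤ r`, exist and are continuous). -/
def IsCmr (m r : ℕ) (Kf : Ed d → Ed d → ℝ) : Prop :=
  ∀ k l : MIdx d, mdeg k ≤ m → mdeg l ≤ r →
    Continuous (fun p : Ed d × Ed d => mixDeriv k l Kf p.1 p.2) ∧
    (mdeg k < m → ∀ (i : Fin d) (x y : Ed d),
      LineDifferentiableAt ℝ (fun x' => mixDeriv k l Kf x' y) x
        (EuclideanSpace.single i (1:ℝ))) ∧
    (mdeg l < r → ∀ (j : Fin d) (x y : Ed d),
      LineDifferentiableAt ℝ (mderiv l (fun y' => Kf x y')) y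
        (EuclideanSpace.single j (1:ℝ)))

/-- `Kn` is the dyadic decomposition of a `β`-regularising kernel of order `(m,r)`
with range `ρ` (Definition 2.3 of the paper). -/
def RegKer (d : ℕ) (β : ℝ) (m r : ℕ) (ρ : ℝ) (Kn : ℕ → Ed d → Ed d → ℝ) : Prop :=
  (∀ n, IsCmr m r (Kn n)) ∧
  (∀ n x y, Kn n x y ≠ 0 → dist x y ≤ ρ * 2 ^ (-(n : ℝ))) ∧
  (∀ K : Set (Ed d), IsCompact K → ∃ c : ℝ, 0 < c ∧
    (∀ n, ∀ k l : MIdx d, mdeg k ≤ m → mdeg l ≤ r → ∀ x ∈ K, ∀ y ∈ K,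
      |mixDeriv k l (Kn n) x y| ≤
        c * 2 ^ ((((d : ℝ) - β + (mdeg l : ℝ) + (mdeg k : ℝ))) * n)) ∧
    (∀ n, ∀ k l : MIdx d, mdeg k ≤ r → mdeg l ≤ r → ∀ y ∈ K,
      |∫ x, mpow (y - x) l * mderiv k (fun y' => Kn n x y') y| ≤ c * 2 ^ (-(β * (n : ℝ)))))

/-- `K_n^* ψ (y) = ∫ ψ(x) K_n(x,y) dx`. -/
def kstar (Kf : Ed d → Ed d → ℝ) (ψ : Ed d → ℝ) : Ed d → ℝ :=
  fun y => ∫ x, ψ x * Kf x y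

/-- `g = 𝖪 f`, i.e. `g(ψ) = Σ_n f(K_n^* ψ)` (with convergence) on test functions. -/
def KInt (Kn : ℕ → Ed d → Ed d → ℝ) (f g : DFunc d) : Prop :=
  ∀ ψ : Ed d → ℝ, IsTest ψ → HasSum (fun n => f (kstar (Kn n) ψ)) (g ψ)

/-- The kernel decomposition preserves polynomials at level `γ`. -/
def PresPoly (Kn : ℕ → Ed d → Ed d → ℝ) (γ : ℝ) : Prop :=
  ∀ n, ∀ k : MIdx d, (mdeg k : ℝ) ≤ γ →
    ∃ p : MvPolynomial (Fin d) ℝ, p.totalDegree ≤ mdeg k ∧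
      ∀ x : Ed d, (∫ y, Kn n x y * mpow y k) = MvPolynomial.eval (fun i => x i) p

/-- Distributional derivative `D^k f (φ) = (-1)^{|k|} f(∂^k φ)`. -/
def distDeriv (k : MIdx d) (f : DFunc d) : DFunc d :=
  fun φ => (-1 : ℝ) ^ (mdeg k) * f (mderiv k φ)

/-- `η ∈ 𝒟` with `∫ η = 1` and vanishing moments of orders `1 ≤ |l| < δ`. -/
def GoodEta (δ : ℝ) (η : Ed d → ℝ) : Prop :=
  IsTest η ∧ (∫ z, η z) = 1 ∧
    ∀ k : MIdx d, 1 ≤ mdeg k → (mdeg k : ℝ) < δ → (∫ z, η z * mpow z k) = 0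

/-- `v` is the pointwise derivative `D^k f(x)`, defined through the limit
`lim_{λ↓0} D^k f(η_x^λ)` for every admissible mollifier `η`. -/
def HasPtDeriv (f : DFunc d) (δ : ℝ) (k : MIdx d) (x : Ed d) (v : ℝ) : Prop :=
  ∀ η : Ed d → ℝ, GoodEta δ η →
    Tendsto (fun l : ℝ => distDeriv k f (scTF η x l)) (nhdsWithin 0 (Set.Ioi 0)) (nhds v)

/-- The Taylor polynomial `Σ_{|k| < δ} c_k (·-x)^k / k!`, viewed as the functional
`ψ ↦ Σ_{|k| < δ} c_k ∫ ψ(y) (y-x)^k / k! dy`. -/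
def taylorF (δ : ℝ) (c : MIdx d → ℝ) (x : Ed d) : DFunc d :=
  fun ψ => ∑ᶠ k ∈ {k : MIdx d | (mdeg k : ℝ) < δ},
    c k * ((∫ y, ψ y * mpow (y - x) k) / (mfact k))

/-- The smallest positive integer `> -γ` (used in Hölder–Zygmund spaces for `γ < 0`). -/
def rNeg (γ : ℝ) : ℕ := (⌊-γ + 1⌋).toNat

/-- The Hölder–Zygmund bound with constant `C` on the compact `K` (with `λ̄ = 1`). -/
def ZBound (γ : ℝ) (f : DFunc d) (K : Set (Ed d)) (C : ℝ) : Prop :=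
  (γ < 0 → ∀ x ∈ K, ∀ l : ℝ, 0 < l → l ≤ 1 → ∀ φ ∈ TB d (rNeg γ),
    |f (scTF φ x l)| ≤ C * l ^ γ) ∧
  (0 ≤ γ →
    (∀ x ∈ K, ∀ ψ ∈ TB d 0, |f (scTF ψ x 1)| ≤ C) ∧
    (∀ x ∈ K, ∀ l : ℝ, 0 < l → l ≤ 1 → ∀ φ ∈ TBAnn d 0 γ,
      |f (scTF φ x l)| ≤ C * l ^ γ))

/-- Membership in the local Hölder–Zygmund space `𝒵^γ`. -/
def MemZ (γ : ℝ) (f : DFunc d) : Prop :=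
  IsDistribution f ∧ ∀ K : Set (Ed d), IsCompact K → ∃ C, ZBound γ f K C

/-- `(Pg, Gg)` is a model with homogeneities `α` of order `rP`, with index set `S`. -/
def IsModelOn {ι : Type} (S : Finset ι) (Pg : ι → GermF d)
    (Gg : ι → ι → Ed d → Ed d → ℝ) (α : ι → ℝ) (rP : ℕ) : Prop :=
  (∀ i ∈ S, IsGerm (Pg i)) ∧
  (∀ i ∈ S, Homog (Pg i) (α i) rP) ∧
  (∀ i ∈ S, ∀ x y : Ed d, ∀ φ : Ed d → ℝ, IsTest φ →
    Pg i y φ = ∑ j ∈ S, Pg j x φ * Gg j i x y)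

/-- The modelled-distribution bound with constant `C` on the compact `K`. -/
def MDB {ι : Type} (S : Finset ι) (Gg : ι → ι → Ed d → Ed d → ℝ) (α : ι → ℝ)
    (γ : ℝ) (f : Ed d → ι → ℝ) (K : Set (Ed d)) (C : ℝ) : Prop :=
  (∀ x ∈ K, ∀ i ∈ S, |f x i| ≤ C) ∧
  (∀ x ∈ K, ∀ y ∈ K, ∀ i ∈ S,
    |(∑ j ∈ S, Gg i j x y * f y j) - f x i| ≤ C * (dist y x) ^ (γ - α i))

/-- `f` is a modelled distribution of order `γ` relative to the model data. -/
def IsMD {ι : Type} (S : Finset ι) (Gg : ι → ι → Ed d → Ed d → ℝ) (α : ι → ℝ)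
    (γ : ℝ) (f : Ed d → ι → ℝ) : Prop :=
  (∀ i ∈ S, Measurable fun x : Ed d => f x i) ∧
  ∀ K : Set (Ed d), IsCompact K → ∃ C, MDB S Gg α γ f K C

/-- The germ `⟨f, Π⟩_x = Σ_i f^i(x) Π^i_x`. -/
def germOf {ι : Type} (S : Finset ι) (Pg : ι → GermF d) (f : Ed d → ι → ℝ) : GermF d :=
  fun x φ => ∑ i ∈ S, f x i * Pg i x φ

/-- Smooth functions as a real vector space. -/
def SmF (d : ℕ) : Submodule ℝ (Ed d → ℝ) where
  carrier := {f | ContDiff ℝ (⊤ : ℕ∞) f}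
  add_mem' := by
    intro a b ha hb
    rw [Set.mem_ofPred_eq] at *
    exact ContDiff.add ha hb
  zero_mem' := by
    rw [Set.mem_ofPred_eq]
    exact contDiff_const
  smul_mem' := by
    intro c f hf
    rw [Set.mem_ofPred_eq] at *
    exact ContDiff.const_smul c hf

/-- Directional derivative as an endomorphism of smooth functions. -/
def Dv (v : Ed d) : Module.End ℝ (SmF d) where
  toFun f := ⟨fun x => fderiv ℝ f.1 x v, by
    have h : ContDiff ℝ (⊤ : ℕ∞) f.1 := f.2
    exact (h.fderiv_right (m := (⊤ : ℕ∞)) (by simp)).clm_apply contDiff_const⟩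
  map_add' f g := by
    have hf : ContDiff ℝ (⊤ : ℕ∞) f.1 := f.2
    have hg : ContDiff ℝ (⊤ : ℕ∞) g.1 := g.2
    ext x
    have := fderiv_add (hf.differentiable (by simp) x) (hg.differentiable (by simp) x)
    simp only [Submodule.coe_add, Pi.add_apply]
    rw [this]; rfl
  map_smul' c f := by
    have hf : ContDiff ℝ (⊤ : ℕ∞) f.1 := f.2
    ext x
    have := fderiv_const_smul (hf.differentiable (by simp) x) c
    simp only [Submodule.coe_smul, Pi.smul_apply, RingHom.id_apply]
    rw [this]; rfl

lemma SmF_contDiff (f : SmF d) : ContDiff ℝ (⊤ : ℕ∞) f.1 := f.2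

lemma SmF_diff (f : SmF d) : Differentiable ℝ f.1 := (SmF_contDiff f).differentiable (by simp)

lemma Dv_apply (v : Ed d) (f : SmF d) (x : Ed d) : (Dv v f).1 x = fderiv ℝ f.1 x v := rfl

lemma Dv_comm (v w : Ed d) : Dv v * Dv w = Dv w * Dv v := by
  ext f x
  change fderiv ℝ (fun x => fderiv ℝ f.1 x w) x v = fderiv ℝ (fun x => fderiv ℝ f.1 x v) x w
  have h2 : Differentiable ℝ (fderiv ℝ f.1) :=
    ((SmF_contDiff f).fderiv_right (m := (⊤ : ℕ∞)) (by simp)).differentiable (by simp)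
  have key : ∀ a b : Ed d, fderiv ℝ (fun x => fderiv ℝ f.1 x a) x b
      = fderiv ℝ (fderiv ℝ f.1) x b a := by
    intro a b
    have := ((h2 x).hasFDerivAt.clm_apply (hasFDerivAt_const a x)).fderiv
    rw [this]; simp
  rw [key, key]
  have hs : IsSymmSndFDerivAt ℝ f.1 x :=
    (SmF_contDiff f).contDiffAt.isSymmSndFDerivAt (by simpa using WithTop.coe_le_coe.2 (le_top (a := (2:ℕ∞))))
  exact hs v w

/-- Coordinate partial derivative. -/
def Pd (i : Fin d) : Module.End ℝ (SmF d) := Dv (EuclideanSpace.single i (1:ℝ))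

lemma Pd_coe (i : Fin d) (f : SmF d) : (Pd i f).1 = pd i f.1 := by
  ext x
  exact ((SmF_diff f x).lineDeriv_eq_fderiv).symm

lemma Pd_pow_coe (i : Fin d) (n : ℕ) (f : SmF d) : ((Pd i ^ n) f).1 = (pd i)^[n] f.1 := by
  induction n generalizing f with
  | zero => rfl
  | succ n ih => rw [pow_succ, Module.End.mul_apply, ih, Pd_coe, Function.iterate_succ_apply]

lemma Dv_eq (v : Ed d) : Dv v = ∑ i, v i • Pd i := by
  ext f x
  have : v = ∑ i, v i • EuclideanSpace.single i (1:ℝ) := by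
    ext j
    simp [Finset.sum_apply, Pi.single_apply]
  conv_lhs => rw [Dv_apply, this]
  rw [map_sum]
  simp only [map_smul, LinearMap.sum_apply, LinearMap.smul_apply]
  rw [AddSubmonoidClass.coe_finsetSum, Finset.sum_apply]
  rfl

open scoped IsMulCommutative in
lemma exists_aeval_comm {A : Type*} [Ring A] [Algebra ℝ A] (d : ℕ) (q : Fin d → A)
    (hq : ∀ i j, q i * q j = q j * q i) :
    ∃ Φ : MvPolynomial (Fin d) ℝ →ₐ[ℝ] A, ∀ i, Φ (MvPolynomial.X i) = q i := by
  have hs : ∀ a ∈ Set.range q, ∀ b ∈ Set.range q, a * b = b * a := by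
    rintro _ ⟨i, rfl⟩ _ ⟨j, rfl⟩
    exact hq i j
  have := Algebra.isMulCommutative_adjoin ℝ hs
  let p : Fin d → Algebra.adjoin ℝ (Set.range q) := fun i => ⟨q i, Algebra.subset_adjoin ⟨i, rfl⟩⟩
  refine ⟨(Algebra.adjoin ℝ (Set.range q)).val.comp (MvPolynomial.aeval p), fun i => ?_⟩
  simp [p]

/-- Polynomials in the partial derivatives: existence. -/
lemma exists_Phi (d : ℕ) : ∃ Φ : MvPolynomial (Fin d) ℝ →ₐ[ℝ] Module.End ℝ (SmF d),
    ∀ i, Φ (MvPolynomial.X i) = Pd i :=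
  exists_aeval_comm d Pd fun _ _ => Dv_comm _ _

/-- Polynomials in the partial derivatives. -/
def Phi (d : ℕ) : MvPolynomial (Fin d) ℝ →ₐ[ℝ] Module.End ℝ (SmF d) := (exists_Phi d).choose

lemma Phi_X (i : Fin d) : Phi d (MvPolynomial.X i) = Pd i := (exists_Phi d).choose_spec i

/-- Iterated partial derivative as an endomorphism. -/
def Mk (k : MIdx d) : Module.End ℝ (SmF d) := Phi d (∏ i, MvPolynomial.X i ^ k i)

lemma Mk_list (k : MIdx d) : Mk k = ((List.finRange d).map (fun i => Pd i ^ k i)).prod := by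
  rw [Mk, Fin.prod_univ_def, map_list_prod, List.map_map]
  congr 1
  apply List.map_congr_left
  intro i _
  simp [Phi_X]

lemma Mk_coe (k : MIdx d) (f : SmF d) : (Mk k f).1 = mderiv k f.1 := by
  rw [Mk_list, mderiv]
  induction List.finRange d with
  | nil => rfl
  | cons i l ih =>
    rw [List.map_cons, List.prod_cons, Module.End.mul_apply, Pd_pow_coe, ih]; rfl

lemma Mk_mul (k j : MIdx d) : Mk k * Mk j = Mk (k + j) := by
  simp only [Mk, ← map_mul, ← Finset.prod_mul_distrib, Pi.add_apply, pow_add]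

lemma Mk_comm (k j : MIdx d) : Mk k * Mk j = Mk j * Mk k := by
  rw [Mk_mul, Mk_mul, add_comm]

lemma Mk_zero : Mk (0 : MIdx d) = 1 := by simp [Mk]

lemma mdeg_add (k j : MIdx d) : mdeg (k + j) = mdeg k + mdeg j := by
  simp [mdeg, Finset.sum_add_distrib]

lemma mem_pa (k : MIdx d) (n : ℕ) : k ∈ Finset.piAntidiag Finset.univ n ↔ mdeg k = n := by
  simp [Finset.mem_piAntidiag, mdeg]

lemma Dv_pow (v : Ed d) (n : ℕ) : (Dv v) ^ n = ∑ k ∈ Finset.piAntidiag Finset.univ n,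
    ((Nat.multinomial Finset.univ k : ℝ) * mpow v k) • Mk k := by
  have h1 : Dv v = Phi d (∑ i, MvPolynomial.C (v i) * MvPolynomial.X i) := by
    rw [Dv_eq, map_sum]
    refine Finset.sum_congr rfl fun i _ => ?_
    rw [← MvPolynomial.smul_eq_C_mul, map_smul, Phi_X]
  rw [h1, ← map_pow, Finset.sum_pow_eq_sum_piAntidiag, map_sum]
  refine Finset.sum_congr rfl fun k _ => ?_
  rw [Mk, ← map_smul]
  congr 1
  simp only [mul_pow, Finset.prod_mul_distrib, mpow, MvPolynomial.smul_eq_C_mul, map_mul, map_prod,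
    map_pow, map_natCast, mul_assoc]

lemma sum_mult (d n : ℕ) : ∑ k ∈ Finset.piAntidiag (Finset.univ : Finset (Fin d)) n,
    (Nat.multinomial Finset.univ k : ℝ) = (d : ℝ) ^ n := by
  have := Finset.sum_pow_eq_sum_piAntidiag (Finset.univ : Finset (Fin d)) (fun _ => (1:ℝ)) n
  simpa using this.symm

lemma mult_fact (k : MIdx d) :
    (Nat.multinomial Finset.univ k : ℝ) / (mdeg k).factorial = 1 / (mfact k : ℝ) := by
  have h := Nat.multinomial_spec (Finset.univ) k
  have h' : (mfact k : ℝ) * Nat.multinomial Finset.univ k = (mdeg k).factorial := by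
    exact_mod_cast h
  have : (mfact k : ℝ) ≠ 0 := by
    simp [mfact, Finset.prod_eq_zero_iff, Nat.factorial_ne_zero]
  rw [div_eq_div_iff (by positivity) this, ← h']; ring

lemma abs_mpow_le (v : Ed d) (k : MIdx d) : |mpow v k| ≤ ‖v‖ ^ mdeg k := by
  rw [mpow, Finset.abs_prod, mdeg, ← Finset.prod_pow_eq_pow_sum]
  refine Finset.prod_le_prod (fun _ _ => abs_nonneg _) fun i _ => ?_
  rw [abs_pow]
  gcongr
  exact PiLp.norm_apply_le v i

lemma taylor1 (N : ℕ) (C : ℝ) : ∀ (g : ℕ → ℝ → ℝ) (_ : ∀ m t, HasDerivAt (g m) (g (m+1) t) t)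
    (_ : ∀ t ∈ Set.Icc (0:ℝ) 1, |g N t| ≤ C), ∀ t ∈ Set.Icc (0:ℝ) 1,
    |g 0 t - ∑ m ∈ Finset.range N, g m 0 * t ^ m / m.factorial| ≤ C := by
  induction N with
  | zero => intro g _ h t ht; simpa using h t ht
  | succ N ih =>
    intro g hg h t ht
    have hC : 0 ≤ C := (abs_nonneg _).trans (h t ht)
    have key := ih (fun m => g (m+1)) (fun m t => hg (m+1) t) h
    let F : ℝ → ℝ := fun t => g 0 t - ∑ m ∈ Finset.range (N+1), g m 0 * t ^ m / m.factorial
    have hF : ∀ t, HasDerivAt F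
        (g 1 t - ∑ m ∈ Finset.range N, g (m+1) 0 * t ^ m / m.factorial) t := by
      intro t
      refine (hg 0 t).sub ?_
      have : (∑ m ∈ Finset.range N, g (m+1) 0 * t ^ m / m.factorial)
         = ∑ m ∈ Finset.range (N+1), g m 0 * (m * t ^ (m-1)) / m.factorial := by
        rw [Finset.sum_range_succ']
        simp only [Nat.cast_zero, zero_mul, mul_zero, zero_div, add_zero]
        refine Finset.sum_congr rfl fun m _ => ?_
        rw [Nat.factorial_succ]
        push_cast
        field_simp
      rw [this]
      refine HasDerivAt.fun_sum fun m _ => ?_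
      exact ((hasDerivAt_pow m t).const_mul _).div_const _
    have := norm_image_sub_le_of_norm_deriv_le_segment' (a := 0) (b := 1) (C := C) (f := F)
      (fun x _ => (hF x).hasDerivWithinAt)
      (fun x hx => by
        rw [Real.norm_eq_abs]
        exact key x ⟨hx.1, hx.2.le⟩) t ht
    have hF0 : F 0 = 0 := by
      simp only [F]
      rw [Finset.sum_range_succ']
      simp
    rw [hF0, sub_zero, sub_zero, Real.norm_eq_abs] at this
    exact this.trans (mul_le_of_le_one_right hC ht.2)

lemma taylorD (N : ℕ) (C : ℝ) (f : SmF d) (v u : Ed d) (h : ∀ z, |((Dv v ^ N) f).1 z| ≤ C) :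
    |f.1 (u + v) - ∑ m ∈ Finset.range N, ((Dv v ^ m) f).1 u / m.factorial| ≤ C := by
  have := taylor1 N C (fun m t => ((Dv v ^ m) f).1 (u + t • v)) (fun m t => by
    have h1 : HasDerivAt (fun t : ℝ => u + t • v) v t := by
      simpa using ((hasDerivAt_id t).smul_const v).const_add u
    have h2 := (SmF_diff ((Dv v ^ m) f) (u + t • v)).hasFDerivAt.comp_hasDerivAt t h1
    rw [pow_succ', Module.End.mul_apply]
    exact h2) (fun t _ => h _) 1 (by simp)
  simpa using this

/-- the finite set of multi-indices of degree `< N`. -/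
def Kset (d N : ℕ) : Finset (MIdx d) := (Finset.range N).biUnion (Finset.piAntidiag Finset.univ)

lemma mem_Kset (N : ℕ) (k : MIdx d) : k ∈ Kset d N ↔ mdeg k < N := by
  simp [Kset, mdeg]

lemma finsum_Kset (N : ℕ) (F : MIdx d → ℝ) :
    ∑ᶠ k ∈ {k : MIdx d | mdeg k < N}, F k = ∑ k ∈ Kset d N, F k := by
  have : {k : MIdx d | mdeg k < N} = ↑(Kset d N) := by
    ext k
    simp [mem_Kset]
  rw [this, finsum_mem_coe_finset]

lemma sum_Kset (N : ℕ) (F : MIdx d → ℝ) : ∑ k ∈ Kset d N, F k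
      = ∑ m ∈ Finset.range N, ∑ k ∈ Finset.piAntidiag Finset.univ m, F k := by
  rw [Kset, Finset.sum_biUnion]
  intro a _ b _ hab
  rw [Function.onFun, Finset.disjoint_left]
  intro k h1 h2
  rw [mem_pa] at h1 h2
  exact hab (h1.symm.trans h2)

lemma taylorM (N : ℕ) (f : SmF d) (v u : Ed d)
    (h : ∀ k : MIdx d, mdeg k = N → ∀ z, |(Mk k f).1 z| ≤ 1) :
    |f.1 (u + v) - ∑ k ∈ Kset d N, mpow v k / (mfact k : ℝ) * (Mk k f).1 u|
      ≤ (d * ‖v‖) ^ N := by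
  have happ : ∀ m z, ((Dv v ^ m) f).1 z = ∑ k ∈ Finset.piAntidiag Finset.univ m,
      (Nat.multinomial Finset.univ k : ℝ) * mpow v k * (Mk k f).1 z := by
    intro m z
    rw [Dv_pow, LinearMap.sum_apply, AddSubmonoidClass.coe_finsetSum, Finset.sum_apply]
    rfl
  have h1 := taylorD N ((d * ‖v‖) ^ N) f v u (fun z => by
    rw [happ, mul_pow, ← sum_mult, Finset.sum_mul]
    refine (Finset.abs_sum_le_sum_abs _ _).trans (Finset.sum_le_sum fun k hk => ?_)
    rw [mem_pa] at hk
    rw [abs_mul, abs_mul, Nat.abs_cast]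
    have := abs_mpow_le v k
    rw [hk] at this
    have h3 := h k hk z
    calc _ ≤ (Nat.multinomial Finset.univ k : ℝ) * ‖v‖ ^ N * 1 := by gcongr
      _ = _ := mul_one _)
  convert h1 using 3
  rw [sum_Kset]
  refine Finset.sum_congr rfl fun m _ => ?_
  rw [happ, Finset.sum_div]
  refine Finset.sum_congr rfl fun k hk => ?_
  rw [mem_pa] at hk
  have := mult_fact k
  rw [hk] at this
  calc _ = (1 / (mfact k : ℝ)) * mpow v k * (Mk k f).1 u := by ring
    _ = _ := by rw [← this]; ring

/-- Composition with an affine map. -/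
def Aff (s : ℝ) (w : Ed d) : Module.End ℝ (SmF d) where
  toFun f := ⟨fun x => f.1 (s • x + w), by
    exact (SmF_contDiff f).comp ((contDiff_id.const_smul s).add contDiff_const)⟩
  map_add' f g := rfl
  map_smul' c f := rfl

lemma Aff_apply (s : ℝ) (w : Ed d) (f : SmF d) (x : Ed d) :
    (Aff s w f).1 x = f.1 (s • x + w) := rfl

lemma Pd_Aff (s : ℝ) (w : Ed d) (i : Fin d) : Pd i * Aff s w = s • (Aff s w * Pd i) := by
  ext f x
  change fderiv ℝ (fun x => f.1 (s • x + w)) x (EuclideanSpace.single i (1:ℝ))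
    = s * fderiv ℝ f.1 (s • x + w) (EuclideanSpace.single i (1:ℝ))
  have h1 : HasFDerivAt (fun x : Ed d => s • x + w) (s • ContinuousLinearMap.id ℝ (Ed d)) x :=
    ((hasFDerivAt_id x).const_smul s).add_const w
  have h2 := (SmF_diff f (s • x + w)).hasFDerivAt.comp x h1
  have h3 : fderiv ℝ (fun x => f.1 (s • x + w)) x = _ := h2.fderiv
  rw [h3]
  simp

lemma Pd_pow_Aff (s : ℝ) (w : Ed d) (i : Fin d) (n : ℕ) :
    Pd i ^ n * Aff s w = s ^ n • (Aff s w * Pd i ^ n) := by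
  induction n with
  | zero => simp
  | succ n ih =>
    rw [pow_succ, mul_assoc, Pd_Aff, mul_smul_comm, ← mul_assoc, ih, smul_mul_assoc, smul_smul,
      mul_assoc, pow_succ']

lemma Mk_Aff (s : ℝ) (w : Ed d) (k : MIdx d) :
    Mk k * Aff s w = s ^ mdeg k • (Aff s w * Mk k) := by
  rw [Mk_list, mdeg, Fin.sum_univ_def]
  induction List.finRange d with
  | nil => simp
  | cons i l ih =>
    simp only [List.map_cons, List.prod_cons, List.sum_cons]
    rw [mul_assoc, ih, mul_smul_comm, ← mul_assoc, Pd_pow_Aff, smul_mul_assoc, smul_smul,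
      mul_assoc, pow_add, mul_comm (s ^ k i)]

/-- Support in the unit ball and vanishing moments. -/
def QQ (N : ℕ) (f : SmF d) : Prop :=
  tsupport f.1 ⊆ closedBall (0 : Ed d) 1 ∧ ∀ m : MIdx d, mdeg m < N → ∫ z, f.1 z * mpow z m = 0

lemma cont_mpow (m : MIdx d) : Continuous (fun z : Ed d => mpow z m) := by
  unfold mpow
  fun_prop

lemma hcs {f : Ed d → ℝ} (h : tsupport f ⊆ closedBall (0 : Ed d) 1) : HasCompactSupport f :=
  (isCompact_closedBall _ _).of_isClosed_subset (isClosed_tsupport _) h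

lemma integ {f g : Ed d → ℝ} (hf : Continuous f) (h : tsupport f ⊆ closedBall (0 : Ed d) 1)
    (hg : Continuous g) : Integrable (fun z => f z * g z) :=
  (hf.mul hg).integrable_of_hasCompactSupport ((hcs h).mul_right)

lemma mpow_line (m : MIdx d) (i : Fin d) (z : Ed d) :
    HasLineDerivAt ℝ (fun z : Ed d => mpow z m)
      (m i * mpow z (Function.update m i (m i - 1))) z (EuclideanSpace.single i (1:ℝ)) := by
  unfold HasLineDerivAt
  have h1 : ∀ t : ℝ, mpow (z + t • EuclideanSpace.single i (1:ℝ)) m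
      = (z i + t) ^ m i * ∏ j ∈ Finset.univ.erase i, z j ^ m j := by
    intro t
    rw [mpow, ← Finset.mul_prod_erase _ _ (Finset.mem_univ i)]
    congr 1
    · simp
    · refine Finset.prod_congr rfl fun j hj => ?_
      have : j ≠ i := Finset.ne_of_mem_erase hj
      simp [this]
  have h2 : mpow z (Function.update m i (m i - 1))
      = z i ^ (m i - 1) * ∏ j ∈ Finset.univ.erase i, z j ^ m j := by
    rw [mpow, ← Finset.mul_prod_erase _ _ (Finset.mem_univ i)]
    congr 1
    · simp
    · refine Finset.prod_congr rfl fun j hj => ?_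
      have : j ≠ i := Finset.ne_of_mem_erase hj
      simp [this]
  simp only [h1, h2]
  have h3 : HasDerivAt (fun t : ℝ => z i + t) 1 0 := (hasDerivAt_id (0:ℝ)).const_add _
  have h4 := (h3.pow (m i)).mul_const (∏ j ∈ Finset.univ.erase i, z j ^ m j)
  rw [add_zero, mul_one, mul_assoc] at h4
  exact h4

lemma QQ_Pd (N : ℕ) (i : Fin d) (f : SmF d) (h : QQ N f) : QQ N (Pd i f) := by
  have hs : tsupport (Pd i f).1 ⊆ closedBall (0 : Ed d) 1 :=
    (tsupport_fderiv_apply_subset ℝ (f := f.1) (EuclideanSpace.single i (1:ℝ))).trans h.1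
  refine ⟨hs, fun m hm => ?_⟩
  have hcf : Continuous f.1 := (SmF_contDiff f).continuous
  have hcp : Continuous (Pd i f).1 := (SmF_contDiff _).continuous
  have key := integral_bilinear_hasLineDerivAt_right_eq_neg_left_of_integrable
    (μ := (volume : Measure (Ed d))) (B := ContinuousLinearMap.mul ℝ ℝ)
    (f := f.1) (f' := (Pd i f).1) (g := fun z => mpow z m)
    (g' := fun z => m i * mpow z (Function.update m i (m i - 1)))
    (v := EuclideanSpace.single i (1:ℝ))
    (integ hcp hs (cont_mpow m)) (integ hcf h.1 ((cont_mpow _).const_mul _))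
    (integ hcf h.1 (cont_mpow m))
    (fun x _ => (SmF_diff f x).hasFDerivAt.hasLineDerivAt _)
    (fun x _ => mpow_line m i x)
  simp only [ContinuousLinearMap.mul_apply'] at key
  have h0 : ∫ x, f.1 x * ((m i : ℝ) * mpow x (Function.update m i (m i - 1))) = 0 := by
    have : mdeg (Function.update m i (m i - 1)) < N := by
      refine lt_of_le_of_lt (Finset.sum_le_sum fun j _ => ?_) hm
      by_cases hj : j = i
      · subst hj; simp
      · simp [hj]
    have h2 := h.2 _ this
    calc _ = ∫ x, (m i : ℝ) * (f.1 x * mpow x (Function.update m i (m i - 1))) := by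
          congr 1; ext x; ring
      _ = 0 := by rw [integral_const_mul, h2, mul_zero]
  rw [h0] at key
  linarith

lemma QQ_Mk (N : ℕ) (k : MIdx d) (f : SmF d) (h : QQ N f) : QQ N (Mk k f) := by
  have hp : ∀ (i : Fin d) (n : ℕ) (g : SmF d), QQ N g → QQ N ((Pd i ^ n) g) := by
    intro i n
    induction n with
    | zero => intro g hg; simpa using hg
    | succ n ih =>
      intro g hg
      rw [pow_succ, Module.End.mul_apply]
      exact ih _ (QQ_Pd N i g hg)
  rw [Mk_list]
  induction List.finRange d with
  | nil => simpa using h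
  | cons i l ih =>
    rw [List.map_cons, List.prod_cons, Module.End.mul_apply]
    exact hp _ _ _ ih

lemma mom_translate (N : ℕ) (f : SmF d) (h : QQ N f) (w : Ed d) (m : MIdx d) (hm : mdeg m < N) :
    ∫ z, f.1 z * mpow (z + w) m = 0 := by
  have hcf : Continuous f.1 := (SmF_contDiff f).continuous
  have h1 : ∀ z : Ed d, f.1 z * mpow (z + w) m
      = ∑ p ∈ Fintype.piFinset (fun i => Finset.range (m i + 1)),
        (f.1 z * mpow z p) * ∏ i, (w i ^ (m i - p i) * ((m i).choose (p i) : ℝ)) := by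
    intro z
    have : mpow (z + w) m = ∏ i, ∑ j ∈ Finset.range (m i + 1),
        z i ^ j * w i ^ (m i - j) * ((m i).choose j : ℝ) := by
      refine Finset.prod_congr rfl fun i _ => ?_
      rw [PiLp.add_apply, add_pow]
    rw [this, Finset.prod_univ_sum, Finset.mul_sum]
    refine Finset.sum_congr rfl fun p _ => ?_
    rw [mpow, mul_assoc, ← Finset.prod_mul_distrib]
    simp only [mul_assoc]
  simp only [h1]
  rw [integral_finsetSum _ (fun p _ => (integ hcf h.1 (cont_mpow p)).mul_const _)]
  refine Finset.sum_eq_zero fun p hp => ?_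
  rw [integral_mul_const, h.2 p, zero_mul]
  refine lt_of_le_of_lt (Finset.sum_le_sum fun j _ => ?_) hm
  have := Fintype.mem_piFinset.1 hp j
  rw [Finset.mem_range] at this
  omega

lemma mom_Aff (N : ℕ) (f : SmF d) (h : QQ N f) (w : Ed d) (m : MIdx d) (hm : mdeg m < N) :
    ∫ z, (Aff 2 w f).1 z * mpow z m = 0 := by
  have h1 : ∀ z : Ed d, (Aff 2 w f).1 z * mpow z m
      = (fun u : Ed d => (fun q : Ed d => f.1 q * mpow (q + -w) m) (u + w) * (1/2) ^ mdeg m)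
        ((2:ℝ) • z) := by
    intro z
    have : mpow ((2:ℝ) • z + w + -w) m = 2 ^ mdeg m * mpow z m := by
      rw [add_neg_cancel_right, mpow, mpow, mdeg, ← Finset.prod_pow_eq_pow_sum,
        ← Finset.prod_mul_distrib]
      refine Finset.prod_congr rfl fun i _ => ?_
      rw [PiLp.smul_apply, smul_eq_mul, mul_pow]
    simp only [this, Aff_apply]
    have h2 : (2:ℝ) ^ mdeg m * (1/2) ^ mdeg m = 1 := by rw [← mul_pow]; norm_num
    linear_combination (-(f.1 ((2:ℝ) • z + w) * mpow z m)) * h2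
  rw [integral_congr_ae (ae_of_all _ h1), Measure.integral_comp_smul volume (fun u : Ed d =>
    (fun q : Ed d => f.1 q * mpow (q + -w) m) (u + w) * (1/2) ^ mdeg m), integral_mul_const,
    integral_add_right_eq_self (fun q : Ed d => f.1 q * mpow (q + -w) m) w,
    mom_translate N f h (-w) m hm]
  simp

/-- The (rescaled) Taylor remainder. -/
def Rem (N : ℕ) (f : SmF d) (v : Ed d) : SmF d :=
  Aff 2 v f - ∑ k ∈ Kset d N, (mpow v k / (mfact k : ℝ)) • Aff 2 0 (Mk k f)

lemma Rem_apply (N : ℕ) (f : SmF d) (v z : Ed d) :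
    (Rem N f v).1 z = f.1 ((2:ℝ) • z + v)
      - ∑ k ∈ Kset d N, mpow v k / (mfact k : ℝ) * (Mk k f).1 ((2:ℝ) • z) := by
  have h : (Rem N f v).1 z = (Aff 2 v f).1 z
      - (∑ k ∈ Kset d N, (mpow v k / (mfact k : ℝ)) • Aff 2 0 (Mk k f)).1 z := rfl
  rw [h, AddSubmonoidClass.coe_finsetSum, Finset.sum_apply]
  congr 1
  refine Finset.sum_congr rfl fun k _ => ?_
  have h2 : ((mpow v k / (mfact k : ℝ)) • Aff 2 0 (Mk k f)).1 z
    = (mpow v k / (mfact k : ℝ)) * (Mk k f).1 ((2:ℝ) • z + 0) := rfl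
  rw [h2, add_zero]

lemma Mk_Rem (N : ℕ) (f : SmF d) (v : Ed d) (j : MIdx d) :
    Mk j (Rem N f v) = (2:ℝ) ^ mdeg j • Rem N (Mk j f) v := by
  have h : ∀ (w : Ed d) (g : SmF d), Mk j (Aff 2 w g) = (2:ℝ) ^ mdeg j • Aff 2 w (Mk j g) := by
    intro w g
    exact LinearMap.congr_fun (Mk_Aff 2 w j) g
  have h' : ∀ k : MIdx d, Mk j (Mk k f) = Mk k (Mk j f) := fun k =>
    LinearMap.congr_fun (Mk_comm j k) f
  simp only [Rem, map_sub, map_sum, map_smul, h, h', smul_sub, Finset.smul_sum]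
  congr 1
  refine Finset.sum_congr rfl fun k _ => ?_
  rw [smul_comm]

lemma Rem_bound (N r : ℕ) (f : SmF d) (v : Ed d)
    (hf : ∀ k : MIdx d, mdeg k ≤ r + N → ∀ z, |(Mk k f).1 z| ≤ 1)
    (j : MIdx d) (hj : mdeg j ≤ r) (z : Ed d) :
    |(Mk j (Rem N f v)).1 z| ≤ 2 ^ r * (d * ‖v‖) ^ N := by
  have h0 : (Mk j (Rem N f v)).1 z = (2:ℝ) ^ mdeg j * (Rem N (Mk j f) v).1 z := by
    rw [Mk_Rem]; rfl
  rw [h0, Rem_apply, abs_mul, abs_of_pos (by positivity : (0:ℝ) < 2 ^ mdeg j)]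
  have h1 := taylorM N (Mk j f) v ((2:ℝ) • z) (fun k hk z => by
    rw [← Module.End.mul_apply, Mk_mul]
    exact hf _ (by rw [mdeg_add]; omega) z)
  have : (2:ℝ) ^ mdeg j ≤ 2 ^ r := pow_le_pow_right₀ (by norm_num) hj
  gcongr

lemma tsupport_Rem (N : ℕ) (f : SmF d) (v : Ed d) (hv : ‖v‖ ≤ 1) (hf : QQ N f) :
    tsupport (Rem N f v).1 ⊆ closedBall (0 : Ed d) 1 := by
  refine closure_minimal ?_ isClosed_closedBall
  intro z hz
  by_contra hzb
  rw [mem_closedBall_zero_iff, not_le] at hzb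
  have h2 : ‖(2:ℝ) • z‖ = 2 * ‖z‖ := by rw [norm_smul]; norm_num
  have hz0 : ∀ g : SmF d, tsupport g.1 ⊆ closedBall (0 : Ed d) 1 → ∀ u : Ed d, 1 < ‖u‖ →
      g.1 u = 0 := by
    intro g hg u hu
    apply image_eq_zero_of_notMem_tsupport
    intro h
    have := hg h
    rw [mem_closedBall_zero_iff] at this
    linarith
  apply hz
  rw [Rem_apply, hz0 f hf.1, Finset.sum_eq_zero, sub_zero]
  · intro k _
    rw [hz0 (Mk k f) (QQ_Mk N k f hf).1 _ (by rw [h2]; linarith), mul_zero]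
  · have := norm_sub_norm_le ((2:ℝ) • z) (-v)
    rw [sub_neg_eq_add, norm_neg] at this
    linarith

lemma mom_Rem (N : ℕ) (f : SmF d) (v : Ed d) (hf : QQ N f)
    (m : MIdx d) (hm : mdeg m < N) : ∫ z, (Rem N f v).1 z * mpow z m = 0 := by
  have hint : ∀ (g : SmF d) (w : Ed d), QQ N g →
      Integrable (fun z => (Aff 2 w g).1 z * mpow z m) := by
    intro g w hg
    have hc : HasCompactSupport (Aff 2 w g).1 := by
      refine HasCompactSupport.intro (isCompact_closedBall (0 : Ed d) (1 + ‖w‖)) fun z hz => ?_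
      rw [Aff_apply]
      apply image_eq_zero_of_notMem_tsupport
      intro h
      have h3 := hg.1 h
      rw [mem_closedBall_zero_iff] at h3 hz
      have h2 : ‖(2:ℝ) • z‖ = 2 * ‖z‖ := by rw [norm_smul]; norm_num
      have := norm_sub_norm_le ((2:ℝ) • z) (-w)
      rw [sub_neg_eq_add, norm_neg] at this
      linarith [norm_nonneg z]
    exact (((SmF_contDiff _).continuous).mul (cont_mpow m)).integrable_of_hasCompactSupport
      hc.mul_right
  have h1 : ∀ z, (Rem N f v).1 z * mpow z m = (Aff 2 v f).1 z * mpow z m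
      - ∑ k ∈ Kset d N, (mpow v k / (mfact k : ℝ)) * ((Aff 2 0 (Mk k f)).1 z * mpow z m) := by
    intro z
    rw [Rem_apply, sub_mul, Finset.sum_mul]
    congr 1
    refine Finset.sum_congr rfl fun k _ => ?_
    rw [Aff_apply, add_zero, mul_assoc]
  simp only [h1]
  rw [integral_sub (hint f v hf)
    (integrable_finsetSum _ fun k _ => (hint _ 0 (QQ_Mk N k f hf)).const_mul _),
    integral_finsetSum _ fun k _ => (hint _ 0 (QQ_Mk N k f hf)).const_mul _,
    mom_Aff N f hf v m hm, Finset.sum_eq_zero, sub_zero]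
  intro k _
  rw [integral_const_mul, mom_Aff N _ (QQ_Mk N k f hf) 0 m hm, mul_zero]

lemma mpow_smul (a : ℝ) (v : Ed d) (k : MIdx d) : mpow (a • v) k = a ^ mdeg k * mpow v k := by
  rw [mpow, mpow, mdeg, ← Finset.prod_pow_eq_pow_sum, ← Finset.prod_mul_distrib]
  refine Finset.prod_congr rfl fun i _ => ?_
  rw [PiLp.smul_apply, smul_eq_mul, mul_pow]

/-- Lemma 5.11, Taylor remainder for rescaled test functions: given
`r ∈ ℕ₀`, `c ∈ ℕ₀ ∪ {-1}`, there is `cst > 0` (depending only on `r,c,d`) such that for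
all `φ ∈ 𝓑^{r+c+1}_c` and `x, y, n` with `|y-x| ≤ 2^{-n}`, there is
`ψ = ψ^{[x,y,n]} ∈ cst·𝓑^r_c` with
`φ_x^{2^{-n}} - Σ_{|k|≤c} ((x-y)^k/k!)(-2^n)^{|k|} (∂^k φ)_y^{2^{-n}}
  = (2^n(x-y))^{c+1} ψ_y^{2^{-n+1}}`. -/
theorem taylor_remainder_rescaled
    (d r : ℕ) (c : ℤ) (hc : -1 ≤ c) :
    ∃ cst : ℝ, 0 < cst ∧
      ∀ φ ∈ TBAnn d (r + (c + 1).toNat) (c : ℝ), ∀ x y : Ed d, ∀ n : ℕ,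
        dist y x ≤ 2 ^ (-(n : ℝ)) →
        ∃ ψ ∈ cst • TBAnn d r (c : ℝ),
          ∀ z : Ed d,
            scTF φ x (2 ^ (-(n : ℝ))) z
              - (∑ᶠ k ∈ {k : MIdx d | (mdeg k : ℤ) ≤ c},
                  (mpow (x - y) k / (mfact k : ℝ)) * (-(2 : ℝ) ^ n) ^ (mdeg k)
                    * scTF (mderiv k φ) y (2 ^ (-(n : ℝ))) z)
              = ((2 : ℝ) ^ n * dist x y) ^ ((c + 1).toNat)
                  * scTF ψ y (2 ^ (-(n : ℝ) + 1)) z := by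
  have hN : ∀ m : ℕ, ((m : ℤ) ≤ c ↔ m < (c + 1).toNat) := by
    intro m; omega
  have hNr : ∀ m : ℕ, ((m : ℝ) ≤ (c : ℝ) ↔ m < (c + 1).toNat) := by
    intro m; rw [← hN]; exact_mod_cast Iff.rfl
  have hset : {k : MIdx d | (mdeg k : ℤ) ≤ c} = {k : MIdx d | mdeg k < (c + 1).toNat} := by
    ext k; exact hN _
  rw [hset]
  generalize (c + 1).toNat = N at *
  refine ⟨2 ^ (d + r) * (d + 1) ^ N, by positivity, ?_⟩
  set cst : ℝ := 2 ^ (d + r) * (d + 1) ^ N with hcst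
  have hcpos : 0 < cst := by positivity
  rintro φ ⟨⟨⟨hφs, hφc⟩, hφt, hφb⟩, ⟨_, _, hφm⟩⟩ x y n hxy
  set f : SmF d := ⟨φ, hφs⟩ with hf
  have hQ : QQ N f := ⟨hφt, fun m hm => hφm m ((hNr _).2 hm)⟩
  have hb : ∀ k : MIdx d, mdeg k ≤ r + N → ∀ z, |(Mk k f).1 z| ≤ 1 := by
    intro k hk z
    rw [Mk_coe]; exact hφb k hk z
  set v : Ed d := (-(2:ℝ) ^ n) • (x - y) with hv
  have hl : (2:ℝ) ^ (-(n:ℝ)) = ((2:ℝ) ^ n)⁻¹ := by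
    rw [Real.rpow_neg (by norm_num), Real.rpow_natCast]
  have hl2 : (2:ℝ) ^ (-(n:ℝ) + 1) = 2 * ((2:ℝ) ^ n)⁻¹ := by
    rw [Real.rpow_add (by norm_num), hl, Real.rpow_one, mul_comm]
  have hvn : ‖v‖ = 2 ^ n * dist x y := by
    rw [hv, norm_smul, norm_neg, norm_pow, dist_eq_norm]; norm_num
  have hv1 : ‖v‖ ≤ 1 := by
    rw [hvn, dist_comm]
    rw [hl] at hxy
    calc _ ≤ (2:ℝ) ^ n * ((2:ℝ) ^ n)⁻¹ := by gcongr
      _ = 1 := mul_inv_cancel₀ (by positivity)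
  set a : ℝ := cst⁻¹ * 2 ^ d * (‖v‖ ^ N)⁻¹ with ha
  set ψ : SmF d := a • Rem N f v with hψ
  have hψa : ∀ z, ψ.1 z = a * (Rem N f v).1 z := fun z => rfl
  have hapos : 0 ≤ a := by positivity
  have hψt : tsupport ψ.1 ⊆ closedBall (0 : Ed d) 1 := by
    refine (closure_mono ?_).trans (tsupport_Rem N f v hv1 hQ)
    intro z hz h0
    apply hz
    rw [hψa, h0, mul_zero]
  have hψT : IsTest ψ.1 := ⟨SmF_contDiff ψ, hcs hψt⟩
  refine ⟨cst • ψ.1, Set.smul_mem_smul_set ⟨⟨hψT, hψt, ?_⟩, hψT, hψt, ?_⟩, ?_⟩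
  · intro j hj z
    rw [← Mk_coe, hψ, map_smul]
    change |a * (Mk j (Rem N f v)).1 z| ≤ 1
    rw [abs_mul, abs_of_nonneg hapos]
    have h1 := Rem_bound N r f v hb j hj z
    have h2 : (‖v‖ ^ N)⁻¹ * ‖v‖ ^ N ≤ 1 := inv_mul_le_one
    have h3 : (d : ℝ) ^ N ≤ (d + 1) ^ N := by gcongr; linarith
    calc a * |(Mk j (Rem N f v)).1 z| ≤ a * (2 ^ r * (d * ‖v‖) ^ N) := by gcongr
      _ = cst⁻¹ * (2 ^ (d + r) * d ^ N) * ((‖v‖ ^ N)⁻¹ * ‖v‖ ^ N) := by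
        rw [ha, mul_pow, pow_add]; ring
      _ ≤ cst⁻¹ * cst * 1 := by rw [hcst]; gcongr
      _ = 1 := by rw [mul_one, inv_mul_cancel₀ hcpos.ne']
  · intro m hm
    simp only [hψa, mul_assoc]
    rw [integral_const_mul, mom_Rem N f v hQ m ((hNr _).1 hm), mul_zero]
  · intro z
    rw [finsum_Kset, ← hvn]
    simp only [scTF, hl, hl2, inv_inv]
    set ζ : Ed d := (2 * ((2:ℝ) ^ n)⁻¹)⁻¹ • (z - y) with hζ
    have h2n : (2:ℝ) ^ n ≠ 0 := by positivity
    have hζ2 : (2:ℝ) • ζ = (2:ℝ) ^ n • (z - y) := by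
      rw [hζ, smul_smul]; congr 1; field_simp
    have hzx : (2:ℝ) ^ n • (z - x) = (2:ℝ) • ζ + v := by
      rw [hζ2, hv, neg_smul, ← sub_eq_add_neg, ← smul_sub]; congr 1; abel
    have hR := Rem_apply N f v ζ
    have hcan : ‖v‖ ^ N * ((‖v‖ ^ N)⁻¹ * (Rem N f v).1 ζ) = (Rem N f v).1 ζ := by
      by_cases h0 : ‖v‖ ^ N = 0
      · have h1 := Rem_bound N r f v hb 0 (by simp [mdeg]) ζ
        rw [mul_pow, h0, mul_zero, mul_zero, Mk_zero, Module.End.one_apply] at h1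
        rw [abs_nonpos_iff.1 h1]; simp
      · rw [mul_inv_cancel_left₀ h0]
    have hR2 : (Rem N f v).1 ζ = φ ((2:ℝ) ^ n • (z - x))
        - ∑ k ∈ Kset d N, mpow (x - y) k / (mfact k : ℝ) * (-(2:ℝ) ^ n) ^ mdeg k
          * mderiv k φ ((2:ℝ) ^ n • (z - y)) := by
      rw [hR, ← hzx, hζ2]
      congr 1
      refine Finset.sum_congr rfl fun k _ => ?_
      rw [Mk_coe, hv, mpow_smul]; ring
    have hψz : (cst • ψ.1) ζ = 2 ^ d * ((‖v‖ ^ N)⁻¹ * (Rem N f v).1 ζ) := by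
      rw [Pi.smul_apply, smul_eq_mul, hψa, ha]
      field_simp
    rw [hψz]
    calc _ = ((((2:ℝ) ^ n)⁻¹) ^ d)⁻¹ * (Rem N f v).1 ζ := by
          rw [hR2, mul_sub, Finset.mul_sum]
          congr 1
          refine Finset.sum_congr rfl fun k _ => ?_
          ring
      _ = ((2 * ((2:ℝ) ^ n)⁻¹) ^ d)⁻¹ * 2 ^ d
            * (‖v‖ ^ N * ((‖v‖ ^ N)⁻¹ * (Rem N f v).1 ζ)) := by
          rw [hcan, mul_pow]
          field_simp
      _ = _ := by ring
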